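/- Let θ > 0. There is no function u : (0,1) → ℝ that is four times continuously differentiable with u''(x) > 0 for all x ∈ (0,1), satisfies u''(x)·u''''(x) = (θ+1)·(u'''(x))² for all x ∈ (0,1), and satisfies the large condition lim_{x→0⁺} u(x) = +∞ and lim_{x→1⁻} u(x) = +∞. -/

import Mathlib

open Set Filter Topology

/-- A concave function on an open bounded interval is bounded above. -/
theorem ConcaveOn.exists_forall_Ioo_le {a b : ℝ} {g : ℝ → ℝ}
    (hg : ConcaveOn ℝ (Ioo a b) g) : ∃ K, ∀ x ∈ Ioo a b, g x ≤ K := by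
  rcases le_or_gt b a with hab | hab
  · exact ⟨0, fun x hx => absurd (hx.1.trans hx.2) hab.not_gt⟩
  obtain ⟨d, had, hdb⟩ := exists_between hab
  obtain ⟨c, hac, hcd⟩ := exists_between had
  obtain ⟨e, hde, heb⟩ := exists_between hdb
  set s := (g d - g c) / (d - c)
  set t := (g e - g d) / (e - d)
  have hs := mul_nonneg (abs_nonneg s) (sub_nonneg.2 hab.le)
  have ht := mul_nonneg (abs_nonneg t) (sub_nonneg.2 hab.le)
  refine ⟨g d + |s| * (b - a) + |t| * (b - a), fun x hx => ?_⟩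
  rcases lt_trichotomy x d with hxd | rfl | hxd
  · have h := hg.slope_anti_adjacent hx ⟨had.trans hde, heb⟩ hxd hde
    rw [le_div_iff₀ (sub_pos.2 hxd)] at h
    have h₁ : -|t| * (d - x) ≤ t * (d - x) :=
      mul_le_mul_of_nonneg_right (neg_abs_le t) (sub_pos.2 hxd).le
    have h₂ : |t| * (d - x) ≤ |t| * (b - a) :=
      mul_le_mul_of_nonneg_left (by linarith [hx.1]) (abs_nonneg t)
    linarith
  · linarith
  · have h := hg.slope_anti_adjacent ⟨hac, hcd.trans hdb⟩ hx hcd hxd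
    rw [div_le_iff₀ (sub_pos.2 hxd)] at h
    have h₁ : s * (x - d) ≤ |s| * (x - d) :=
      mul_le_mul_of_nonneg_right (le_abs_self s) (sub_pos.2 hxd).le
    have h₂ : |s| * (x - d) ≤ |s| * (b - a) :=
      mul_le_mul_of_nonneg_left (by linarith [hx.2]) (abs_nonneg s)
    linarith

/-- A function whose second derivative is bounded above on a bounded open interval is itself
bounded above there. -/
theorem exists_forall_Ioo_le_of_second_deriv_le {a b C : ℝ} {f f' f'' : ℝ → ℝ}
    (hf : ∀ x ∈ Ioo a b, HasDerivAt f (f' x) x) (hf' : ∀ x ∈ Ioo a b, HasDerivAt f' (f'' x) x)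
    (hC : ∀ x ∈ Ioo a b, f'' x ≤ C) : ∃ K, ∀ x ∈ Ioo a b, f x ≤ K := by
  have hd : ∀ x ∈ Ioo a b,
      HasDerivAt (fun y => f y - C / 2 * y ^ 2) (f' x - C * x) x := fun x hx => by
    refine ((hf x hx).sub ((hasDerivAt_pow 2 x).const_mul (C / 2))).congr_deriv ?_
    push_cast
    ring
  have hd' : ∀ x ∈ Ioo a b, HasDerivAt (fun y => f' y - C * y) (f'' x - C) x := fun x hx => by
    refine ((hf' x hx).sub ((hasDerivAt_id x).const_mul C)).congr_deriv ?_
    rw [mul_one]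
  have hconc : ConcaveOn ℝ (Ioo a b) (fun y => f y - C / 2 * y ^ 2) := by
    refine concaveOn_of_hasDerivWithinAt2_nonpos (f' := fun y => f' y - C * y)
      (f'' := fun y => f'' y - C) (convex_Ioo a b)
      (fun x hx => (hd x hx).continuousAt.continuousWithinAt) ?_ ?_ ?_ <;>
    rw [interior_Ioo] <;> intro x hx
    · exact (hd x hx).hasDerivWithinAt
    · exact (hd' x hx).hasDerivWithinAt
    · exact sub_nonpos.2 (hC x hx)
  obtain ⟨K, hK⟩ := hconc.exists_forall_Ioo_le
  refine ⟨K + |C| / 2 * (a ^ 2 + b ^ 2), fun x hx => ?_⟩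
  have hx2 : x ^ 2 ≤ a ^ 2 + b ^ 2 := by
    rcases le_total 0 x with h | h <;> nlinarith [hx.1, hx.2, sq_nonneg a, sq_nonneg b]
  have h₁ : C * x ^ 2 ≤ |C| * x ^ 2 := mul_le_mul_of_nonneg_right (le_abs_self C) (sq_nonneg x)
  have h₂ : |C| * x ^ 2 ≤ |C| * (a ^ 2 + b ^ 2) := mul_le_mul_of_nonneg_left hx2 (abs_nonneg C)
  linarith [hK x hx]

theorem ContDiffOn.hasDerivAt_iteratedDeriv {n k : ℕ} {s : Set ℝ} {f : ℝ → ℝ} {x : ℝ}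
    (hf : ContDiffOn ℝ n f s) (hs : IsOpen s) (hk : k < n) (hx : x ∈ s) :
    HasDerivAt (iteratedDeriv k f) (iteratedDeriv (k + 1) f x) x := by
  rw [iteratedDeriv_succ]
  have h := hf.differentiableOn_iteratedDerivWithin (m := k) (by exact_mod_cast hk) hs.uniqueDiffOn
  exact ((h.congr fun y hy =>
    (iteratedDerivWithin_of_isOpen hs hy).symm).differentiableAt (hs.mem_nhds hx)).hasDerivAt

/-- If `v v'' = p (v')²` with `v > 0` on an interval, then `v' / v ^ p` is constant, so `v` is
monotone or antitone. -/
theorem monotoneOn_or_antitoneOn_of_mul_second_deriv_eq {a b p : ℝ} {v v' v'' : ℝ → ℝ}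
    (hv : ∀ x ∈ Ioo a b, HasDerivAt v (v' x) x) (hv' : ∀ x ∈ Ioo a b, HasDerivAt v' (v'' x) x)
    (hpos : ∀ x ∈ Ioo a b, 0 < v x) (hode : ∀ x ∈ Ioo a b, v x * v'' x = p * v' x ^ 2) :
    MonotoneOn v (Ioo a b) ∨ AntitoneOn v (Ioo a b) := by
  have hd : ∀ x ∈ Ioo a b, HasDerivAt (fun y => v' y * v y ^ (-p)) 0 x := fun x hx => by
    have hx0 := hpos x hx
    refine ((hv' x hx).mul ((hv x hx).rpow_const (p := -p) (Or.inl hx0.ne'))).congr_deriv ?_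
    rw [Real.rpow_sub_one hx0.ne']
    field_simp
    linear_combination v x ^ (-p) * hode x hx
  obtain ⟨c, hc⟩ := isOpen_Ioo.exists_is_const_of_deriv_eq_zero isPreconnected_Ioo
    (fun x hx => (hd x hx).differentiableAt.differentiableWithinAt)
    (fun x hx => (hd x hx).deriv)
  have hcont : ContinuousOn v (Ioo a b) :=
    fun x hx => (hv x hx).continuousAt.continuousWithinAt
  rcases le_total 0 c with h0 | h0
  · left
    refine monotoneOn_of_deriv_nonneg (convex_Ioo a b) hcont ?_ ?_ <;>
    rw [interior_Ioo]
    · exact fun x hx => (hv x hx).differentiableAt.differentiableWithinAt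
    · intro x hx
      rw [(hv x hx).deriv]
      exact nonneg_of_mul_nonneg_left (h0.trans_eq (hc x hx).symm)
        (Real.rpow_pos_of_pos (hpos x hx) _)
  · right
    refine antitoneOn_of_deriv_nonpos (convex_Ioo a b) hcont ?_ ?_ <;>
    rw [interior_Ioo]
    · exact fun x hx => (hv x hx).differentiableAt.differentiableWithinAt
    · intro x hx
      rw [(hv x hx).deriv]
      exact nonpos_of_mul_nonpos_left ((hc x hx).trans_le h0)
        (Real.rpow_pos_of_pos (hpos x hx) _)

/-- One-dimensional Bernstein theorem on a bounded interval: there is no strictly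
convex `C⁴` solution of the affine maximal type ODE on `(0,1)` blowing up at both
endpoints. -/
theorem stmt_1 (θ : ℝ) (hθ : 0 < θ) :
    ¬ ∃ u : ℝ → ℝ,
      ContDiffOn ℝ 4 u (Set.Ioo 0 1) ∧
      (∀ x ∈ Set.Ioo (0:ℝ) 1, 0 < iteratedDeriv 2 u x) ∧
      (∀ x ∈ Set.Ioo (0:ℝ) 1, iteratedDeriv 2 u x * iteratedDeriv 4 u x
        = (θ + 1) * (iteratedDeriv 3 u x) ^ 2) ∧
      Filter.Tendsto u (nhdsWithin 0 (Set.Ioi 0)) Filter.atTop ∧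
      Filter.Tendsto u (nhdsWithin 1 (Set.Iio 1)) Filter.atTop := by
  rintro ⟨u, hu, hpos, hode, h0, h1⟩
  have hd : ∀ k < 4, ∀ x ∈ Ioo (0 : ℝ) 1,
      HasDerivAt (iteratedDeriv k u) (iteratedDeriv (k + 1) u x) x :=
    fun k hk x hx => ContDiffOn.hasDerivAt_iteratedDeriv (n := 4) hu isOpen_Ioo hk hx
  have hd0 : ∀ x ∈ Ioo (0 : ℝ) 1, HasDerivAt u (iteratedDeriv 1 u x) x := by
    simpa using hd 0 (by norm_num)
  have hmid : (1 / 2 : ℝ) ∈ Ioo (0 : ℝ) 1 := by norm_num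
  rcases monotoneOn_or_antitoneOn_of_mul_second_deriv_eq (hd 2 (by norm_num))
    (hd 3 (by norm_num)) hpos hode with hm | hm
  · have hsub : Ioo (0 : ℝ) (1 / 2) ⊆ Ioo 0 1 := Ioo_subset_Ioo_right (by norm_num)
    obtain ⟨K, hK⟩ := exists_forall_Ioo_le_of_second_deriv_le
      (fun x hx => hd0 x (hsub hx)) (fun x hx => hd 1 (by norm_num) x (hsub hx))
      (fun x hx => hm (hsub hx) hmid hx.2.le)
    obtain ⟨x, hx, hKx⟩ := (Filter.Eventually.and (Ioo_mem_nhdsGT (by norm_num : (0 : ℝ) < 1 / 2))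
      (h0.eventually_gt_atTop K)).exists
    exact hKx.not_ge (hK x hx)
  · have hsub : Ioo (1 / 2 : ℝ) 1 ⊆ Ioo 0 1 := Ioo_subset_Ioo_left (by norm_num)
    obtain ⟨K, hK⟩ := exists_forall_Ioo_le_of_second_deriv_le
      (fun x hx => hd0 x (hsub hx)) (fun x hx => hd 1 (by norm_num) x (hsub hx))
      (fun x hx => hm hmid (hsub hx) hx.1.le)
    obtain ⟨x, hx, hKx⟩ := (Filter.Eventually.and (Ioo_mem_nhdsLT (by norm_num : (1 / 2 : ℝ) < 1))
      (h1.eventually_gt_atTop K)).exists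
    exact hKx.not_ge (hK x hx)
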